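/- arXiv:2403.14363 — 2 statements merged into one kernel-verified Lean document; each statement's English description precedes it below -/
import Mathlib

section
/- Let α, β be finite types, n ≥ 1, and let {(η i, ρ i)}_{i ∈ Fin n} be an ensemble of density matrices on Matrix (α × β) (α × β) ℂ. Then η 0 is the greatest element of the set { ∑ i, η i * (Tr (Γ(ρ i) * M i)).re | M a POVM with n outcomes } (i.e., IsGreatest of this set at η 0) if and only if for every i ∈ Fin n the matrix η 0 • Γ(ρ 0) − η i • Γ(ρ i) is positive semidefinite. -/
open Matrix BigOperators
open scoped ComplexOrder

/-- A POVM with `n` outcomes: each element is positive semidefinite and they sum to the identity. -/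
def IsPOVM {ι : Type*} [Fintype ι] [DecidableEq ι] {n : ℕ} (M : Fin n → Matrix ι ι ℂ) : Prop :=
  (∀ i, (M i).PosSemidef) ∧ ∑ i, M i = 1

/-- Partial transposition (with respect to the second subsystem) on a bipartite system. -/
def ptAB {α β : Type*} (ρ : Matrix (α × β) (α × β) ℂ) : Matrix (α × β) (α × β) ℂ :=
  Matrix.of fun p q => ρ (p.1, q.2) (q.1, p.2)

/-- The average success functional of a family of measurement operators is `η i * Re Tr (σ i * P)`
on the family supported at `i` with value `P`. -/
lemma sum_mul_re_trace_mul_single {ι κ : Type*} [Fintype ι] [Fintype κ] [DecidableEq κ]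
    (η : κ → ℝ) (σ : κ → Matrix ι ι ℂ) (i : κ) (P : Matrix ι ι ℂ) :
    ∑ j, η j * ((σ j * (Pi.single i P : κ → Matrix ι ι ℂ) j).trace).re
      = η i * ((σ i * P).trace).re := by
  rw [Finset.sum_eq_single i]
  · simp
  · intro j _ hj
    simp [Pi.single_eq_of_ne hj]
  · simp

lemma Matrix.PosSemidef.re_trace_mul_nonneg {ι : Type*} [Fintype ι] [DecidableEq ι]
    {A B : Matrix ι ι ℂ} (hA : A.PosSemidef) (hB : B.PosSemidef) : 0 ≤ ((A * B).trace).re := by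
  open scoped MatrixOrder in
  obtain ⟨C, rfl⟩ := CStarAlgebra.nonneg_iff_eq_star_mul_self.mp hB.nonneg
  rw [← mul_assoc, Matrix.trace_mul_comm, ← mul_assoc, Matrix.star_eq_conjTranspose]
  exact (Complex.nonneg_iff.mp (hA.mul_mul_conjTranspose_same C).trace_nonneg).1

lemma Matrix.IsHermitian.posSemidef_of_mul_self {ι : Type*} [Fintype ι]
    {P : Matrix ι ι ℂ} (hP : P.IsHermitian) (hPP : P * P = P) : P.PosSemidef := by
  have h := Matrix.posSemidef_conjTranspose_mul_self P
  rwa [hP.eq, hPP] at h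

/-- A Hermitian matrix is positive semidefinite if its trace against every orthogonal projection
has nonnegative real part. -/
lemma Matrix.IsHermitian.posSemidef_of_re_trace_mul_nonneg {ι : Type*} [Fintype ι]
    {A : Matrix ι ι ℂ} (hA : A.IsHermitian)
    (h : ∀ P : Matrix ι ι ℂ, P.IsHermitian → P * P = P → 0 ≤ ((A * P).trace).re) :
    A.PosSemidef := by
  refine .of_dotProduct_mulVec_nonneg hA fun v => ?_
  rcases eq_or_ne v 0 with rfl | hv
  · simp
  have hpos : 0 < star v ⬝ᵥ v := Matrix.dotProduct_star_self_pos_iff.mpr hv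
  obtain ⟨s, hs⟩ : ∃ s : ℝ, star v ⬝ᵥ v = s :=
    ⟨_, Complex.eq_re_of_ofReal_le hpos.le⟩
  rw [hs, Complex.zero_lt_real] at hpos
  have hP := h (s⁻¹ • vecMulVec v (star v))
    (by simp [Matrix.IsHermitian, conjTranspose_smul, conjTranspose_vecMulVec])
    (by
      rw [smul_mul_smul_comm, vecMulVec_mul_vecMulVec, hs, vecMulVec_smul, Complex.coe_smul,
        smul_smul]
      congr 1
      field_simp)
  rw [mul_smul_comm, mul_vecMulVec, trace_smul, trace_vecMulVec, Complex.smul_re, smul_eq_mul,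
    dotProduct_comm] at hP
  refine Complex.nonneg_iff.mpr ⟨nonneg_of_mul_nonneg_right hP (inv_pos.mpr hpos), ?_⟩
  exact (hA.im_star_dotProduct_mulVec_self v).symm

lemma isHermitian_ptAB {α β : Type*} {ρ : Matrix (α × β) (α × β) ℂ} (h : ρ.IsHermitian) :
    (ptAB ρ).IsHermitian := by
  ext p q
  exact h.apply _ _

lemma trace_ptAB {α β : Type*} [Fintype α] [Fintype β] (ρ : Matrix (α × β) (α × β) ℂ) :
    (ptAB ρ).trace = ρ.trace := rfl

/-- A projective two-outcome measurement, with outcomes labelled `k` and `i`. -/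
lemma isPOVM_single_add_single {ι : Type*} [Fintype ι] [DecidableEq ι] {n : ℕ} (k i : Fin n)
    {P : Matrix ι ι ℂ} (hP : P.IsHermitian) (hPP : P * P = P) :
    IsPOVM (Pi.single k (1 - P) + Pi.single i P : Fin n → Matrix ι ι ℂ) := by
  have hsingle (l j : Fin n) {Q : Matrix ι ι ℂ} (hQ : Q.PosSemidef) :
      ((Pi.single l Q : Fin n → Matrix ι ι ℂ) j).PosSemidef := by
    rcases eq_or_ne j l with rfl | hj
    · simpa using hQ
    · simpa [Pi.single_eq_of_ne hj] using Matrix.PosSemidef.zero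
  have hQ : (1 - P).PosSemidef :=
    (Matrix.isHermitian_one.sub hP).posSemidef_of_mul_self (by simp [mul_sub, sub_mul, hPP])
  refine ⟨fun j => (hsingle k j hQ).add (hsingle i j (hP.posSemidef_of_mul_self hPP)), ?_⟩
  simp [Finset.sum_add_distrib]

theorem stmt1 {α β : Type*} [Fintype α] [DecidableEq α] [Fintype β] [DecidableEq β]
    {n : ℕ} (hn : 0 < n)
    (η : Fin n → ℝ) (ρ : Fin n → Matrix (α × β) (α × β) ℂ)
    (hη : ∀ i, 0 < η i) (hsum : ∑ i, η i = 1)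
    (hρ : ∀ i, (ρ i).PosSemidef ∧ (ρ i).trace = 1) :
    IsGreatest
      {x : ℝ | ∃ M : Fin n → Matrix (α × β) (α × β) ℂ, IsPOVM M ∧
        x = ∑ i, η i * ((ptAB (ρ i) * M i).trace).re}
      (η ⟨0, hn⟩)
    ↔ ∀ i, ((η ⟨0, hn⟩) • ptAB (ρ ⟨0, hn⟩) - η i • ptAB (ρ i)).PosSemidef := by
  set k : Fin n := ⟨0, hn⟩
  have htr (i : Fin n) : (ptAB (ρ i)).trace = 1 := (trace_ptAB _).trans (hρ i).2
  have hherm (i : Fin n) : (ptAB (ρ i)).IsHermitian := isHermitian_ptAB (hρ i).1.isHermitian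
  constructor
  · rintro ⟨-, hub⟩ i
    have hsa (j : Fin n) : (η j • ptAB (ρ j)).IsHermitian := by
      rw [Matrix.IsHermitian, conjTranspose_smul, (hherm j).eq, star_trivial]
    refine ((hsa k).sub (hsa i)).posSemidef_of_re_trace_mul_nonneg fun P hP hPP => ?_
    have hle := hub ⟨_, isPOVM_single_add_single k i hP hPP, rfl⟩
    simp only [Pi.add_apply, mul_add, trace_add, Complex.add_re, Finset.sum_add_distrib,
      sum_mul_re_trace_mul_single η (fun j => ptAB (ρ j))] at hle
    simp only [mul_sub, mul_one, trace_sub, htr, Complex.sub_re, Complex.one_re] at hle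
    simp only [sub_mul, smul_mul_assoc, trace_sub, trace_smul, Complex.sub_re, Complex.smul_re,
      smul_eq_mul]
    linarith
  · intro h
    constructor
    · refine ⟨_, isPOVM_single_add_single k k (P := 0) (by simp) (by simp), ?_⟩
      simp [sum_mul_re_trace_mul_single η (fun j => ptAB (ρ j)), htr]
    · rintro x ⟨M, ⟨hM, hM1⟩, rfl⟩
      calc ∑ i, η i * ((ptAB (ρ i) * M i).trace).re
          ≤ ∑ i, η k * ((ptAB (ρ k) * M i).trace).re := by
            refine Finset.sum_le_sum fun i _ => ?_
            have hi := (h i).re_trace_mul_nonneg (hM i)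
            simp only [sub_mul, smul_mul_assoc, trace_sub, trace_smul, Complex.sub_re,
              Complex.smul_re, smul_eq_mul] at hi
            linarith
        _ = η k := by
            rw [← Finset.mul_sum, ← Complex.re_sum, ← trace_sum, ← Finset.mul_sum, hM1, mul_one,
              htr, Complex.one_re, mul_one]
end

section
/- Let α, β be finite types, L ≥ 1, and let {(η i, ρ i)}_{i ∈ Fin 2} be a two-state ensemble of density matrices on Matrix (α × β) (α × β) ℂ such that η 0 • Γ(ρ 0) − η 1 • Γ(ρ 1) is positive semidefinite. Then the value 1/2 + (1/2)*(2*(η 0) − 1)^L (which equals η_0^{(L)}) is the greatest element of the set { ∑ i, η_i^{(L)} * (Tr (Γ(ρ_i^{(L)}) * M i)).re | M a POVM with 2 outcomes on the L-fold space (indexed by Fin L → α × β) }. -/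
open Matrix BigOperators
open scoped ComplexOrder

/-- Probability of the string `c` in the `L`-fold ensemble. -/
def etaC {n : ℕ} (L : ℕ) (η : Fin n → ℝ) (c : Fin L → Fin n) : ℝ := ∏ l, η (c l)

/-- The `L`-fold tensor-product state labelled by the string `c`. -/
def rhoC {ι : Type*} {n : ℕ} (L : ℕ) (ρ : Fin n → Matrix ι ι ℂ) (c : Fin L → Fin n) :
    Matrix (Fin L → ι) (Fin L → ι) ℂ :=
  Matrix.of fun x y => ∏ l, ρ (c l) (x l) (y l)

/-- The modulo-`n` sum of the entries of `c`. -/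
def omg {n : ℕ} (L : ℕ) (hn : 0 < n) (c : Fin L → Fin n) : Fin n :=
  ⟨(∑ l, (c l).val) % n, Nat.mod_lt _ hn⟩

/-- The probability `η_i^{(L)}` of the grouped `L`-fold ensemble. -/
def etaL {n : ℕ} (L : ℕ) (hn : 0 < n) (η : Fin n → ℝ) (i : Fin n) : ℝ :=
  ∑ c ∈ Finset.univ.filter (fun c : Fin L → Fin n => omg L hn c = i), etaC L η c

/-- The state `ρ_i^{(L)}` of the grouped `L`-fold ensemble. -/
noncomputable def rhoL {ι : Type*} {n : ℕ} (L : ℕ) (hn : 0 < n) (η : Fin n → ℝ)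
    (ρ : Fin n → Matrix ι ι ℂ) (i : Fin n) : Matrix (Fin L → ι) (Fin L → ι) ℂ :=
  (etaL L hn η i)⁻¹ •
    ∑ c ∈ Finset.univ.filter (fun c : Fin L → Fin n => omg L hn c = i), etaC L η c • rhoC L ρ c

/-- Partial transposition on the `L`-fold bipartite space. -/
def ptL {α β : Type*} (L : ℕ) (σ : Matrix (Fin L → α × β) (Fin L → α × β) ℂ) :
    Matrix (Fin L → α × β) (Fin L → α × β) ℂ :=
  Matrix.of fun x y => σ (fun l => ((x l).1, (y l).2)) (fun l => ((y l).1, (x l).2))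

open scoped MatrixOrder in
theorem Matrix.PosSemidef.exists_eq_conjTranspose_mul_self {ι : Type*} [Fintype ι]
    [DecidableEq ι] {A : Matrix ι ι ℂ} (hA : A.PosSemidef) : ∃ B : Matrix ι ι ℂ, A = Bᴴ * B :=
  CStarAlgebra.nonneg_iff_eq_star_mul_self.mp hA.nonneg

/-- The matrix whose entries are the products of the entries of `A` is the tensor power of `A`,
and it is positive semidefinite when `A` is. -/
theorem Matrix.PosSemidef.tensorPower {ι κ : Type*} [Fintype ι] [DecidableEq ι] [Fintype κ]
    [DecidableEq κ] {A : Matrix ι ι ℂ} (hA : A.PosSemidef) :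
    (Matrix.of fun x y : κ → ι => ∏ l, A (x l) (y l)).PosSemidef := by
  obtain ⟨B, rfl⟩ := hA.exists_eq_conjTranspose_mul_self
  have h : (Matrix.of fun x y : κ → ι => ∏ l, (Bᴴ * B) (x l) (y l)) =
      (Matrix.of fun x y : κ → ι => ∏ l, B (x l) (y l))ᴴ *
        Matrix.of fun x y : κ → ι => ∏ l, B (x l) (y l) := by
    ext x y
    simp only [Matrix.of_apply, Matrix.mul_apply, Matrix.conjTranspose_apply, star_prod,
      ← Finset.prod_mul_distrib]
    rw [Finset.prod_univ_sum, Fintype.piFinset_univ]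
  rw [h]
  exact posSemidef_conjTranspose_mul_self _

theorem trace_mul_re_nonneg {ι : Type*} [Fintype ι] [DecidableEq ι] {A B : Matrix ι ι ℂ}
    (hA : A.PosSemidef) (hB : B.PosSemidef) : 0 ≤ (A * B).trace.re := by
  obtain ⟨C, rfl⟩ := hA.exists_eq_conjTranspose_mul_self
  rw [Matrix.mul_assoc, Matrix.trace_mul_comm]
  exact (Complex.le_def.mp (hB.mul_mul_conjTranspose_same C).trace_nonneg).1

theorem sum_omg_add {R : Type*} [CommRing R] {L : ℕ} (h : 0 < 2) (f : Fin L → Fin 2 → R) :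
    ∑ c with omg L h c = 0, ∏ l, f l (c l) + ∑ c with omg L h c = 1, ∏ l, f l (c l) =
      ∏ l, (f l 0 + f l 1) := by
  simp_rw [← Fin.sum_univ_two (f _), Finset.prod_univ_sum, Fintype.piFinset_univ]
  rw [← Finset.sum_fiberwise Finset.univ (omg L h) (fun c => ∏ l, f l (c l)), Fin.sum_univ_two]

theorem sum_omg_sub {R : Type*} [CommRing R] {L : ℕ} (h : 0 < 2) (f : Fin L → Fin 2 → R) :
    ∑ c with omg L h c = 0, ∏ l, f l (c l) - ∑ c with omg L h c = 1, ∏ l, f l (c l) =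
      ∏ l, (f l 0 - f l 1) := by
  have key (c : Fin L → Fin 2) :
      ∏ l, (-1) ^ (c l).val * f l (c l) = (-1) ^ (omg L h c).val * ∏ l, f l (c l) := by
    rw [Finset.prod_mul_distrib, Finset.prod_pow_eq_pow_sum, neg_one_pow_eq_pow_mod_two]
    rfl
  have := sum_omg_add h fun l i => (-1) ^ i.val * f l i
  simp only [key] at this
  rw [Finset.sum_congr (s₂ := {c | omg L h c = 0}) (g := fun c => ∏ l, f l (c l)) rfl,
    Finset.sum_congr (s₂ := {c | omg L h c = 1}) (g := fun c => -∏ l, f l (c l)) rfl] at this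
  · simpa [sub_eq_add_neg] using this
  · intro c hc
    simp [(Finset.mem_filter.mp hc).2]
  · intro c hc
    simp [(Finset.mem_filter.mp hc).2]

theorem etaL_zero_eq {L : ℕ} (h : 0 < 2) {η : Fin 2 → ℝ} (hsum : ∑ i, η i = 1) :
    etaL L h η 0 = 1 / 2 + 1 / 2 * (2 * η 0 - 1) ^ L := by
  have hadd := sum_omg_add h fun (_ : Fin L) i => η i
  have hsub := sum_omg_sub h fun (_ : Fin L) i => η i
  rw [Fin.sum_univ_two] at hsum
  simp only [Finset.prod_const, Finset.card_univ, Fintype.card_fin, hsum, one_pow] at hadd hsub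
  rw [show η 0 - η 1 = 2 * η 0 - 1 by linarith] at hsub
  unfold etaL etaC
  linarith

/-- The weighted grouped state `η_i^{(L)} ρ_i^{(L)}` needs no normalization. -/
theorem etaL_smul_rhoL {ι : Type*} {n L : ℕ} (h : 0 < n) {η : Fin n → ℝ} (hη : ∀ i, 0 < η i)
    (ρ : Fin n → Matrix ι ι ℂ) (i : Fin n) :
    etaL L h η i • rhoL L h η ρ i = ∑ c with omg L h c = i, etaC L η c • rhoC L ρ c := by
  by_cases h0 : etaL L h η i = 0
  · have hz := (Finset.sum_eq_zero_iff_of_nonneg fun c _ =>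
      (Finset.prod_pos fun l _ => hη (c l)).le).mp h0
    rw [h0, zero_smul, Finset.sum_eq_zero]
    intro c hc
    rw [show etaC L η c = 0 from hz c hc, zero_smul]
  · rw [rhoL, smul_inv_smul₀ h0]

theorem trace_ptL {α β : Type*} [Fintype α] [Fintype β] {L : ℕ}
    (σ : Matrix (Fin L → α × β) (Fin L → α × β) ℂ) : (ptL L σ).trace = σ.trace :=
  rfl

theorem trace_rhoC {ι : Type*} [Fintype ι] [DecidableEq ι] {n L : ℕ} {ρ : Fin n → Matrix ι ι ℂ}
    (hρ : ∀ i, (ρ i).trace = 1) (c : Fin L → Fin n) : (rhoC L ρ c).trace = 1 := by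
  have h := Finset.prod_univ_sum (fun _ : Fin L => (Finset.univ : Finset ι))
    fun l x => ρ (c l) x x
  rw [Fintype.piFinset_univ] at h
  refine h.symm.trans (Finset.prod_eq_one fun l _ => hρ (c l))

theorem trace_ptL_etaL_smul_rhoL {α β : Type*} [Fintype α] [DecidableEq α] [Fintype β]
    [DecidableEq β] {n L : ℕ} (h : 0 < n) {η : Fin n → ℝ} (hη : ∀ i, 0 < η i)
    {ρ : Fin n → Matrix (α × β) (α × β) ℂ} (hρ : ∀ i, (ρ i).trace = 1) (i : Fin n) :
    (ptL L (etaL L h η i • rhoL L h η ρ i)).trace = etaL L h η i := by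
  rw [trace_ptL, etaL_smul_rhoL h hη, Matrix.trace_sum]
  simp [trace_rhoC hρ, etaL]

/-- The difference of the two weighted grouped partial transposes is the `L`-th tensor power of the
difference of the single-copy ones. -/
theorem ptL_etaL_smul_rhoL_sub {α β : Type*} {L : ℕ} (h : 0 < 2) {η : Fin 2 → ℝ}
    (hη : ∀ i, 0 < η i) (ρ : Fin 2 → Matrix (α × β) (α × β) ℂ) :
    ptL L (etaL L h η 0 • rhoL L h η ρ 0) - ptL L (etaL L h η 1 • rhoL L h η ρ 1) =
      Matrix.of fun x y : Fin L → α × β =>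
        ∏ l, (η 0 • ptAB (ρ 0) - η 1 • ptAB (ρ 1)) (x l) (y l) := by
  ext x y
  have key := sum_omg_sub h fun (l : Fin L) i => (η i : ℂ) * ptAB (ρ i) (x l) (y l)
  rw [etaL_smul_rhoL h hη, etaL_smul_rhoL h hη]
  simpa [ptL, ptAB, rhoC, etaC, Matrix.sum_apply, Finset.prod_mul_distrib] using key

theorem stmt6 {α β : Type*} [Fintype α] [DecidableEq α] [Fintype β] [DecidableEq β]
    {L : ℕ} (hL : 1 ≤ L)
    (η : Fin 2 → ℝ) (ρ : Fin 2 → Matrix (α × β) (α × β) ℂ)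
    (hη : ∀ i, 0 < η i) (hsum : ∑ i, η i = 1)
    (hρ : ∀ i, (ρ i).PosSemidef ∧ (ρ i).trace = 1)
    (hpt : (η 0 • ptAB (ρ 0) - η 1 • ptAB (ρ 1)).PosSemidef) :
    IsGreatest
      {x : ℝ | ∃ M : Fin 2 → Matrix (Fin L → α × β) (Fin L → α × β) ℂ, IsPOVM M ∧
        x = ∑ i, etaL L (by omega) η i *
          ((ptL L (rhoL L (by omega) η ρ i) * M i).trace).re}
      (1 / 2 + 1 / 2 * (2 * η 0 - 1) ^ L) := by
  have h2 : 0 < 2 := by omega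
  set S : Fin 2 → Matrix (Fin L → α × β) (Fin L → α × β) ℂ :=
    fun i => ptL L (etaL L h2 η i • rhoL L h2 η ρ i) with hS
  have hval (M : Fin 2 → Matrix (Fin L → α × β) (Fin L → α × β) ℂ) :
      ∑ i, etaL L h2 η i * ((ptL L (rhoL L h2 η ρ i) * M i).trace).re =
        (S 0 * M 0).trace.re + (S 1 * M 1).trace.re := by
    have hpt_smul (i : Fin 2) : S i = etaL L h2 η i • ptL L (rhoL L h2 η ρ i) := rfl
    simp [Fin.sum_univ_two, hpt_smul]
  have htr : (S 0).trace.re = 1 / 2 + 1 / 2 * (2 * η 0 - 1) ^ L := by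
    rw [← etaL_zero_eq h2 hsum, hS, trace_ptL_etaL_smul_rhoL h2 hη fun i => (hρ i).2,
      Complex.ofReal_re]
  constructor
  · refine ⟨![1, 0], ⟨?_, by simp⟩, ?_⟩
    · intro i
      fin_cases i
      · exact PosSemidef.one
      · exact PosSemidef.zero
    · rw [hval, ← htr]
      simp
  · rintro _ ⟨M, ⟨hM, hM1⟩, rfl⟩
    rw [hval, ← htr]
    have hdiff : (S 0 - S 1).PosSemidef := by
      rw [hS, ptL_etaL_smul_rhoL_sub h2 hη]
      exact hpt.tensorPower
    have hnonneg := trace_mul_re_nonneg hdiff (hM 1)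
    rw [Fin.sum_univ_two] at hM1
    have hsplit : S 0 = S 0 * M 0 + S 0 * M 1 := by rw [← Matrix.mul_add, hM1, Matrix.mul_one]
    have hsplit_tr := congrArg (fun A => A.trace.re) hsplit
    simp only [Matrix.trace_add, Complex.add_re] at hsplit_tr
    simp only [Matrix.sub_mul, Matrix.trace_sub, Complex.sub_re] at hnonneg
    linarith
end
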